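/- arXiv:1406.2774 — 6 statements merged into one kernel-verified Lean document; each statement's English description precedes it below -/
import Mathlib

section
/- For every n×n complex matrix T there exist n×n complex matrices N and Q such that T = N + Q, N is normal (N* N = N N*), Q is nilpotent, and N has the same characteristic polynomial as T (so the eigenvalues of N, with multiplicity, are exactly those of T). -/
open Matrix

open Module in
/-- **Schur triangularization** for a linear endomorphism of a finite-dimensional complex inner
product space. -/
theorem LinearMap.exists_orthonormal_inner_map_eq_zero {n : ℕ} {V : Type*}
    [NormedAddCommGroup V] [InnerProductSpace ℂ V] (hV : finrank ℂ V = n) [FiniteDimensional ℂ V]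
    (f : V →ₗ[ℂ] V) :
    ∃ b : Fin n → V, Orthonormal ℂ b ∧ ∀ i j, j < i → inner ℂ (b i) (f (b j)) = 0 := by
  induction n generalizing V with
  | zero => exact ⟨Fin.elim0, ⟨fun i => i.elim0, fun i => i.elim0⟩, fun i => i.elim0⟩
  | succ n ih =>
    have : Nontrivial V := nontrivial_of_finrank_pos (R := ℂ) (by omega)
    obtain ⟨μ, hμ⟩ := End.exists_eigenvalue f
    obtain ⟨v₀, hv₀⟩ := hμ.exists_hasEigenvector
    obtain ⟨v, hv, hfv⟩ : ∃ v : V, ‖v‖ = 1 ∧ f v = μ • v :=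
      ⟨((‖v₀‖⁻¹ : ℝ) : ℂ) • v₀, by simp [norm_smul, hv₀.2], by
        rw [map_smul, hv₀.apply_eq_smul, smul_comm]⟩
    have : Fact (finrank ℂ V = n + 1) := ⟨hV⟩
    let W := (Submodule.span ℂ {v})ᗮ
    have hW : finrank ℂ W = n :=
      Submodule.finrank_orthogonal_span_singleton (norm_ne_zero_iff.mp (by simp [hv]))
    obtain ⟨b, hb, hbf⟩ := ih hW (W.orthogonalProjectionOnto.toLinearMap ∘ₗ f ∘ₗ W.subtype)
    have hvb (i : Fin n) : inner ℂ v (b i : V) = 0 :=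
      Submodule.mem_orthogonal_singleton_iff_inner_right.mp (b i).2
    refine ⟨Matrix.vecCons v fun i => (b i : V), ?_, fun i j hij => ?_⟩
    · exact orthonormal_vecCons_iff.mpr ⟨hv, hvb, hb.comp_linearIsometry W.subtypeₗᵢ⟩
    · cases i using Fin.cases with
      | zero => exact absurd hij (Fin.not_lt_zero j)
      | succ i =>
        cases j using Fin.cases with
        | zero => simp [hfv, inner_eq_zero_symm.mp (hvb i)]
        | succ j => simpa using hbf i j (Fin.succ_lt_succ_iff.mp hij)

/-- **Schur triangularization**: every complex matrix is unitarily similar to an upper triangular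
matrix. -/
theorem Matrix.exists_unitary_conj_isUpperTriangular {n : ℕ} (T : Matrix (Fin n) (Fin n) ℂ) :
    ∃ U R : Matrix (Fin n) (Fin n) ℂ,
      Uᴴ * U = 1 ∧ R.IsUpperTriangular ∧ T = U * R * Uᴴ := by
  obtain ⟨b, hb, hbT⟩ := LinearMap.exists_orthonormal_inner_map_eq_zero
    (finrank_euclideanSpace_fin (𝕜 := ℂ) (n := n)) (toEuclideanLin T)
  let U : Matrix (Fin n) (Fin n) ℂ := of fun i j => b j i
  have hU : Uᴴ * U = 1 := by
    ext i j
    rw [one_apply, ← orthonormal_iff_ite.mp hb i j]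
    simp [U, mul_apply, PiLp.inner_apply, mul_comm]
  have hU' : U * Uᴴ = 1 := mul_eq_one_comm.mp hU
  refine ⟨U, Uᴴ * (T * U), hU, fun i j hij => ?_, ?_⟩
  · rw [← hbT i j hij]
    simp [U, mul_apply, PiLp.inner_apply, mul_comm, mulVec, dotProduct]
  · rw [← mul_assoc, hU', one_mul, mul_assoc, hU', mul_one]

/-- A strictly upper triangular matrix is nilpotent. -/
theorem Matrix.IsUpperTriangular.isNilpotent_of_diag_eq_zero {m R : Type*} [Fintype m]
    [LinearOrder m] [CommRing R] {M : Matrix m m R} (hM : M.IsUpperTriangular)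
    (hd : ∀ i, M i i = 0) : IsNilpotent M := by
  refine ⟨Fintype.card m, ?_⟩
  simpa [charpoly_of_isUpperTriangular M hM, hd] using aeval_self_charpoly M

/-- Every complex matrix decomposes as `N + Q` with `N` normal, `Q` nilpotent, and
`N` having the same characteristic polynomial (hence the same eigenvalues with
multiplicity) as `T`. -/
theorem normal_plus_nilpotent_decomposition {n : ℕ}
    (T : Matrix (Fin n) (Fin n) ℂ) :
    ∃ N Q : Matrix (Fin n) (Fin n) ℂ,
      T = N + Q ∧ Nᴴ * N = N * Nᴴ ∧ IsNilpotent Q ∧ N.charpoly = T.charpoly := by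
  obtain ⟨U, R, hU, hR, rfl⟩ := Matrix.exists_unitary_conj_isUpperTriangular T
  have charpoly_conj (A : Matrix (Fin n) (Fin n) ℂ) : (U * A * Uᴴ).charpoly = A.charpoly := by
    rw [Matrix.charpoly_mul_comm, ← mul_assoc, hU, one_mul]
  have conj_mul (A B : Matrix (Fin n) (Fin n) ℂ) :
      U * A * Uᴴ * (U * B * Uᴴ) = U * (A * B) * Uᴴ := by
    simp only [mul_assoc]
    rw [← mul_assoc Uᴴ U, hU, one_mul]
  let D : Matrix (Fin n) (Fin n) ℂ := diagonal R.diag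
  have hD : D.IsUpperTriangular := blockTriangular_diagonal _
  refine ⟨U * D * Uᴴ, U * (R - D) * Uᴴ, ?_, ?_, ?_, ?_⟩
  · rw [← add_mul, ← mul_add, add_sub_cancel]
  · have hN : (U * D * Uᴴ)ᴴ = U * Dᴴ * Uᴴ := by simp [mul_assoc]
    rw [hN, conj_mul, conj_mul]
    simp [D, diagonal_conjTranspose, mul_comm]
  · obtain ⟨k, hk⟩ := IsUpperTriangular.isNilpotent_of_diag_eq_zero (hR.sub hD) (by simp [D])
    have conj_pow (l : ℕ) : (U * (R - D) * Uᴴ) ^ (l + 1) = U * (R - D) ^ (l + 1) * Uᴴ := by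
      induction l with
      | zero => simp
      | succ l ih => rw [pow_succ, ih, conj_mul, ← pow_succ]
    exact ⟨k + 1, by rw [conj_pow, pow_succ, hk]; simp⟩
  · rw [charpoly_conj, charpoly_conj, charpoly_of_isUpperTriangular R hR, charpoly_diagonal]
    rfl
end

section
/- Let ψ : [0,1] → ℂ be a Borel measurable function such that ψ([0,t]) is a Borel set for every t ∈ [0,1] and the set Z is Borel. Then the collection S = {b ⊆ [0,1] : ψ(b ∩ X) is a Borel subset of ℂ} is a σ-algebra of subsets of [0,1] that contains every open subset of [0,1]. -/
/-- `ψ` is injective on the set of its minimizing preimage points. -/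
theorem injOn_setOf_isLeast_preimage {α β : Type*} [PartialOrder α] (ψ : α → β) :
    Set.InjOn ψ {t | IsLeast (ψ ⁻¹' {ψ t}) t} := by
  intro s hs t ht hst
  rw [Set.mem_ofPred_eq, hst] at hs
  exact hs.unique ht

/-- The values of `ψ` at minimizing preimage points are the points whose fibre has a minimum. -/
theorem image_setOf_isLeast_preimage {α β : Type*} [Preorder α] (ψ : α → β) :
    ψ '' {t | IsLeast (ψ ⁻¹' {ψ t}) t} = {z | ∃ t, IsLeast (ψ ⁻¹' {z}) t} := by
  ext z
  constructor
  · rintro ⟨t, ht, rfl⟩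
    exact ⟨t, ht⟩
  · rintro ⟨t, ht⟩
    obtain rfl : ψ t = z := ht.1
    exact ⟨t, ht, rfl⟩

theorem image_Iic_inter_setOf_isLeast_preimage {α β : Type*} [Preorder α] (ψ : α → β) (a : α) :
    ψ '' (Set.Iic a ∩ {t | IsLeast (ψ ⁻¹' {ψ t}) t}) =
      ψ '' Set.Iic a ∩ {z | ∃ t, IsLeast (ψ ⁻¹' {z}) t} := by
  ext z
  constructor
  · rintro ⟨t, ⟨hta, ht⟩, rfl⟩
    exact ⟨⟨t, hta, rfl⟩, t, ht⟩
  · rintro ⟨⟨s, hs, rfl⟩, t, ht⟩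
    have hts : ψ t = ψ s := ht.1
    refine ⟨t, ⟨(ht.2 rfl).trans hs, ?_⟩, hts⟩
    rwa [Set.mem_ofPred_eq, hts]

/-- If `ψ` is injective on `X` and `ψ '' X` is measurable, the sets `b` for which `ψ '' (b ∩ X)`
is measurable form a σ-algebra. -/
@[reducible]
def imageInterMeasurableSpace {α β : Type*} [MeasurableSpace β] (ψ : α → β) (X : Set α)
    (hinj : Set.InjOn ψ X) (hX : MeasurableSet (ψ '' X)) : MeasurableSpace α where
  MeasurableSet' b := MeasurableSet (ψ '' (b ∩ X))
  measurableSet_empty := by simp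
  measurableSet_compl b hb := by
    have h : bᶜ ∩ X = X \ (b ∩ X) := by
      ext
      simp only [Set.mem_inter_iff, Set.mem_compl_iff, Set.mem_sdiff]
      tauto
    rw [h, hinj.image_sdiff_subset Set.inter_subset_right]
    exact hX.diff hb
  measurableSet_iUnion f hf := by
    rw [Set.iUnion_inter, Set.image_iUnion]
    exact MeasurableSet.iUnion hf


/-- Under the measurability hypotheses on `ψ`, the collection
`S = {b ⊆ [0,1] : ψ(b ∩ X) is Borel}` is a σ-algebra containing all open sets:
it contains `∅`, is closed under complements and countable unions, and contains
every open subset of `[0,1]`. -/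
theorem image_min_set_sigma_algebra (ψ : unitInterval → ℂ)
    (hψ : Measurable ψ)
    (Z : Set ℂ) (hZ : Z = {z : ℂ | ∃ t, IsLeast (ψ ⁻¹' {z}) t})
    (X : Set unitInterval) (hX : X = {t : unitInterval | IsLeast (ψ ⁻¹' {ψ t}) t})
    (hIcc : ∀ t : unitInterval, MeasurableSet (ψ '' (Set.Icc 0 t)))
    (hZm : MeasurableSet Z) :
    MeasurableSet (ψ '' ((∅ : Set unitInterval) ∩ X)) ∧
    (∀ b : Set unitInterval,
        MeasurableSet (ψ '' (b ∩ X)) → MeasurableSet (ψ '' (bᶜ ∩ X))) ∧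
    (∀ f : ℕ → Set unitInterval,
        (∀ n, MeasurableSet (ψ '' (f n ∩ X))) →
          MeasurableSet (ψ '' ((⋃ n, f n) ∩ X))) ∧
    (∀ v : Set unitInterval, IsOpen v → MeasurableSet (ψ '' (v ∩ X))) := by
  subst hZ hX
  rw [← image_setOf_isLeast_preimage] at hZm
  let m := imageInterMeasurableSpace ψ _ (injOn_setOf_isLeast_preimage ψ) hZm
  have hborel : borel unitInterval ≤ m := by
    rw [borel_eq_generateFrom_Iic]
    refine MeasurableSpace.generateFrom_le ?_
    rintro _ ⟨t, rfl⟩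
    change MeasurableSet (ψ '' (Set.Iic t ∩ _))
    rw [image_Iic_inter_setOf_isLeast_preimage, ← image_setOf_isLeast_preimage]
    have h : Set.Iic t = Set.Icc 0 t := Set.Icc_bot.symm
    rw [h]
    exact (hIcc t).inter hZm
  exact ⟨m.measurableSet_empty, m.measurableSet_compl, m.measurableSet_iUnion,
    fun v hv => hborel v (MeasurableSpace.measurableSet_generateFrom hv)⟩
end

section
/- Let ψ : [0,1] → ℂ be a Borel measurable function such that ψ([0,t]) is a Borel set for every t ∈ [0,1] and the set Z is Borel. Then for every Borel set b ⊆ [0,1], the image ψ(b ∩ X) is a Borel subset of ℂ. -/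
/-- Under the measurability hypotheses on `ψ`, for every Borel set `b ⊆ [0,1]`,
the image `ψ(b ∩ X)` is a Borel subset of `ℂ`. -/
theorem image_min_set_measurable (ψ : unitInterval → ℂ)
    (hψ : Measurable ψ)
    (Z : Set ℂ) (hZ : Z = {z : ℂ | ∃ t, IsLeast (ψ ⁻¹' {z}) t})
    (X : Set unitInterval) (hX : X = {t : unitInterval | IsLeast (ψ ⁻¹' {ψ t}) t})
    (hIcc : ∀ t : unitInterval, MeasurableSet (ψ '' (Set.Icc 0 t)))
    (hZm : MeasurableSet Z) :
    ∀ b : Set unitInterval, MeasurableSet b → MeasurableSet (ψ '' (b ∩ X)) := by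
  intro b hb
  have hleast : ∀ z : Z, ∃ t, IsLeast (ψ ⁻¹' {(z : ℂ)}) t := fun z => hZ.subset z.2
  choose g hg using hleast
  have hg_meas : Measurable g := by
    refine measurable_of_Iic fun t => ?_
    have hpre : g ⁻¹' Set.Iic t = Subtype.val ⁻¹' (ψ '' Set.Icc 0 t) := by
      ext z
      constructor
      · exact fun h => ⟨g z, ⟨unitInterval.nonneg', h⟩, (hg z).1⟩
      · rintro ⟨s, hs, hsz⟩
        exact ((hg z).2 hsz).trans hs.2
    rw [hpre]
    exact measurable_subtype_coe (hIcc t)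
  have himage : ψ '' (b ∩ X) = Subtype.val '' (g ⁻¹' b) := by
    subst hX
    ext z
    constructor
    · rintro ⟨t, ⟨htb, ht⟩, rfl⟩
      refine ⟨⟨ψ t, hZ.superset ⟨t, ht⟩⟩, ?_, rfl⟩
      rw [Set.mem_preimage, (hg ⟨ψ t, _⟩).unique ht]
      exact htb
    · rintro ⟨z, hz, rfl⟩
      have hgz : ψ (g z) = z := (hg z).1
      refine ⟨g z, ⟨hz, ?_⟩, hgz⟩
      rw [Set.mem_ofPred_eq, hgz]
      exact hg z
  rw [himage]
  exact hZm.subtype_image (hg_meas hb)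
end

section
/- Let ψ : [0,1] → ℂ be a Borel measurable function such that ψ([0,t]) is a Borel set for every t ∈ [0,1] and the set Z is Borel, and let ν be a Borel probability measure on ℂ with ν(Z) = 1. Then the set function μ defined on Borel subsets b ⊆ [0,1] by μ(b) = ν(ψ(b ∩ X)) is countably additive on pairwise disjoint Borel sets, μ(∅) = 0, and μ([0,1]) = 1; that is, μ is a Borel probability measure on [0,1]. -/
open MeasureTheory

/-- A selection `g` of least preimage points is measurable as soon as the images of the initial
segments `[0, t]` are measurable. -/
theorem measurable_of_isLeast_preimage {ψ : unitInterval → ℂ}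
    (hIcc : ∀ t : unitInterval, MeasurableSet (ψ '' (Set.Icc 0 t)))
    {Z : Set ℂ} {g : Z → unitInterval} (hg : ∀ z : Z, IsLeast (ψ ⁻¹' {(z : ℂ)}) (g z)) :
    Measurable g := by
  refine measurable_of_Iic fun t => ?_
  have h : g ⁻¹' Set.Iic t = Subtype.val ⁻¹' (ψ '' Set.Icc 0 t) := by
    ext z
    constructor
    · exact fun h => ⟨g z, ⟨bot_le, h⟩, (hg z).1⟩
    · rintro ⟨s, hs, hsz⟩
      exact ((hg z).2 hsz).trans hs.2
  rw [h]
  exact measurable_subtype_coe (hIcc t)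

/-- The image under `ψ` of the least preimage points lying in `b` is the set of values whose least
preimage point lies in `b`. -/
theorem image_inter_isLeast_preimage {α β : Type*} [PartialOrder α] {ψ : α → β}
    {g : {z : β | ∃ t, IsLeast (ψ ⁻¹' {z}) t} → α}
    (hg : ∀ z : {z : β | ∃ t, IsLeast (ψ ⁻¹' {z}) t}, IsLeast (ψ ⁻¹' {(z : β)}) (g z))
    (b : Set α) :
    ψ '' (b ∩ {t : α | IsLeast (ψ ⁻¹' {ψ t}) t}) = Subtype.val '' (g ⁻¹' b) := by
  ext z
  constructor
  · rintro ⟨t, ⟨htb, ht⟩, rfl⟩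
    refine ⟨⟨ψ t, t, ht⟩, ?_, rfl⟩
    rw [Set.mem_preimage, (hg ⟨ψ t, t, ht⟩).unique ht]
    exact htb
  · rintro ⟨z, hzb, rfl⟩
    have hz : ψ (g z) = z := (hg z).1
    refine ⟨g z, ⟨hzb, ?_⟩, hz⟩
    rw [Set.mem_ofPred_eq, hz]
    exact hg z

/-- The set function `μ(b) = ν(ψ(b ∩ X))` is a Borel probability measure on `[0,1]`:
`μ(∅) = 0`, `μ([0,1]) = 1`, and `μ` is countably additive on pairwise disjoint
Borel sets. -/
theorem pushforward_min_set_probability_measure (ψ : unitInterval → ℂ)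
    (hψ : Measurable ψ)
    (Z : Set ℂ) (hZ : Z = {z : ℂ | ∃ t, IsLeast (ψ ⁻¹' {z}) t})
    (X : Set unitInterval) (hX : X = {t : unitInterval | IsLeast (ψ ⁻¹' {ψ t}) t})
    (hIcc : ∀ t : unitInterval, MeasurableSet (ψ '' (Set.Icc 0 t)))
    (hZm : MeasurableSet Z)
    (ν : Measure ℂ) [IsProbabilityMeasure ν] (hν : ν Z = 1)
    (μ : Set unitInterval → ENNReal)
    (hμ : ∀ b : Set unitInterval, μ b = ν (ψ '' (b ∩ X))) :
    μ (∅ : Set unitInterval) = 0 ∧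
    μ (Set.univ : Set unitInterval) = 1 ∧
    (∀ f : ℕ → Set unitInterval, (∀ n, MeasurableSet (f n)) →
        Pairwise (Function.onFun Disjoint f) →
        μ (⋃ n, f n) = ∑' n, μ (f n)) := by
  subst hZ hX
  choose g hg using fun z : {z : ℂ | ∃ t, IsLeast (ψ ⁻¹' {z}) t} => z.2
  have hgm : Measurable g := measurable_of_isLeast_preimage hIcc hg
  have hμg : ∀ b, μ b = ν (Subtype.val '' (g ⁻¹' b)) := fun b => by
    rw [hμ, image_inter_isLeast_preimage hg]
  refine ⟨by simp [hμg], ?_, fun f hf hd => ?_⟩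
  · rw [hμg, Set.preimage_univ, Set.image_univ, Subtype.range_coe, hν]
  · simp only [hμg, Set.preimage_iUnion, Set.image_iUnion]
    refine measure_iUnion (fun i j hij => ?_) fun n => hZm.subtype_image (hgm (hf n))
    exact (Set.disjoint_image_iff Subtype.val_injective).2 ((hd hij).preimage g)
end

section
/- Let ψ : [0,1] → ℂ be a Borel measurable function such that ψ([0,t]) is a Borel set for every t ∈ [0,1] and the set Z is Borel, let ν be a Borel probability measure on ℂ with ν(Z) = 1, and let μ be the Borel probability measure on [0,1] defined by μ(b) = ν(ψ(b ∩ X)) for Borel b ⊆ [0,1]. Then for every Borel set B ⊆ ℂ one has μ(ψ⁻¹(B)) = ν(B). -/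
open MeasureTheory

/-- The image of `ψ⁻¹(B)` restricted to the minimizing preimage points is the part of `B` whose
fibres have a least element. -/
theorem image_preimage_inter_isLeast {α β : Type*} [Preorder α] (ψ : α → β) (B : Set β) :
    ψ '' (ψ ⁻¹' B ∩ {t | IsLeast (ψ ⁻¹' {ψ t}) t}) =
      B ∩ {z | ∃ t, IsLeast (ψ ⁻¹' {z}) t} := by
  ext z
  constructor
  · rintro ⟨t, ⟨htB, ht⟩, rfl⟩
    exact ⟨htB, t, ht⟩
  · rintro ⟨hzB, t, ht⟩
    obtain rfl : ψ t = z := ht.1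
    exact ⟨t, ⟨hzB, ht⟩, rfl⟩

/-- If `μ` is the Borel probability measure on `[0,1]` given by `μ(b) = ν(ψ(b ∩ X))`
for Borel `b`, then for every Borel set `B ⊆ ℂ` we have `μ(ψ⁻¹(B)) = ν(B)`. -/
theorem pushforward_min_set_preimage_eq (ψ : unitInterval → ℂ)
    (hψ : Measurable ψ)
    (Z : Set ℂ) (hZ : Z = {z : ℂ | ∃ t, IsLeast (ψ ⁻¹' {z}) t})
    (X : Set unitInterval) (hX : X = {t : unitInterval | IsLeast (ψ ⁻¹' {ψ t}) t})
    (hIcc : ∀ t : unitInterval, MeasurableSet (ψ '' (Set.Icc 0 t)))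
    (hZm : MeasurableSet Z)
    (ν : Measure ℂ) [IsProbabilityMeasure ν] (hν : ν Z = 1)
    (μ : Measure unitInterval) [IsProbabilityMeasure μ]
    (hμ : ∀ b : Set unitInterval, MeasurableSet b → μ b = ν (ψ '' (b ∩ X))) :
    ∀ B : Set ℂ, MeasurableSet B → μ (ψ ⁻¹' B) = ν B := by
  intro B hB
  have hZ_compl : ν Zᶜ = 0 := (prob_compl_eq_zero_iff hZm).mpr hν
  rw [hμ _ (hψ hB), hX, image_preimage_inter_isLeast, ← hZ]
  exact measure_inter_conull hZ_compl
end

section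
/- Let H be a complex Hilbert space and let A, B be bounded linear operators on H with A B = B A, ‖A‖ ≤ 1 and ‖B‖ ≤ 1. Then for every m ∈ ℕ and every vector η ∈ H with ‖η‖ ≤ 1, one has ‖(A − B)^{2m} η‖ ≤ 2^{2m} · max(‖B‖^m, ‖A^m η‖). -/
theorem norm_clm_pow_apply_le {𝕜 E : Type*} [NontriviallyNormedField 𝕜]
    [SeminormedAddCommGroup E] [NormedSpace 𝕜 E] (T : E →L[𝕜] E) (n : ℕ) (x : E) :
    ‖(T ^ n) x‖ ≤ ‖T‖ ^ n * ‖x‖ := by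
  induction n with
  | zero => simp
  | succ n ih =>
    rw [pow_succ', pow_succ', mul_assoc]
    exact (T.le_opNorm _).trans (mul_le_mul_of_nonneg_left ih (norm_nonneg T))

theorem norm_clm_pow_apply_le_of_norm_le_one {𝕜 E : Type*} [NontriviallyNormedField 𝕜]
    [SeminormedAddCommGroup E] [NormedSpace 𝕜 E] {T : E →L[𝕜] E} (hT : ‖T‖ ≤ 1)
    (n : ℕ) (x : E) : ‖(T ^ n) x‖ ≤ ‖x‖ :=
  (norm_clm_pow_apply_le T n x).trans
    (mul_le_of_le_one_left (norm_nonneg x) (pow_le_one₀ (norm_nonneg T) hT))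

/-- A mixed power of total degree `2 * m` contains either `m` factors `A` or `m` factors `T`. -/
theorem norm_pow_mul_pow_apply_le_max {𝕜 E : Type*} [NontriviallyNormedField 𝕜]
    [SeminormedAddCommGroup E] [NormedSpace 𝕜 E] {A T : E →L[𝕜] E} (hAT : Commute A T)
    (hA : ‖A‖ ≤ 1) (hT : ‖T‖ ≤ 1) {m k l : ℕ} (hkl : k + l = 2 * m) {x : E} (hx : ‖x‖ ≤ 1) :
    ‖(A ^ k * T ^ l) x‖ ≤ max (‖T‖ ^ m) ‖(A ^ m) x‖ := by
  rcases le_total m l with hl | hk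
  · refine le_max_of_le_left ?_
    calc ‖(A ^ k * T ^ l) x‖ ≤ ‖(T ^ l) x‖ := norm_clm_pow_apply_le_of_norm_le_one hA k _
      _ ≤ ‖T‖ ^ l * ‖x‖ := norm_clm_pow_apply_le T l x
      _ ≤ ‖T‖ ^ l := mul_le_of_le_one_right (by positivity) hx
      _ ≤ ‖T‖ ^ m := pow_le_pow_of_le_one (norm_nonneg T) hT hl
  · refine le_max_of_le_right ?_
    obtain ⟨j, rfl⟩ : ∃ j, k = j + m := ⟨k - m, by omega⟩
    rw [(hAT.pow_pow _ _).eq, pow_add]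
    exact (norm_clm_pow_apply_le_of_norm_le_one hT l _).trans
      (norm_clm_pow_apply_le_of_norm_le_one hA j _)

/-- For commuting contractions `A`, `B` on a complex Hilbert space and any unit-ball
vector `η`, `‖(A - B)^(2m) η‖ ≤ 2^(2m) * max(‖B‖^m, ‖A^m η‖)`. -/
theorem commuting_contractions_power_estimate
    {H : Type*} [NormedAddCommGroup H] [InnerProductSpace ℂ H] [CompleteSpace H]
    (A B : H →L[ℂ] H) (hAB : A * B = B * A) (hA : ‖A‖ ≤ 1) (hB : ‖B‖ ≤ 1) :
    ∀ (m : ℕ) (η : H), ‖η‖ ≤ 1 →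
      ‖((A - B) ^ (2 * m)) η‖ ≤ 2 ^ (2 * m) * max (‖B‖ ^ m) (‖(A ^ m) η‖) := by
  intro m η hη
  have hcomm : Commute A (-B) := Commute.neg_right hAB
  rw [sub_eq_add_neg, hcomm.add_pow', sum_apply]
  have hsum : (2 : ℝ) ^ (2 * m) =
      ∑ p ∈ Finset.HasAntidiagonal.antidiagonal (2 * m), ((2 * m).choose p.1 : ℝ) := by
    rw [Finset.Nat.sum_antidiagonal_eq_sum_range_succ_mk]
    exact_mod_cast (Nat.sum_range_choose (2 * m)).symm
  rw [hsum, Finset.sum_mul]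
  refine norm_sum_le_of_le _ fun p hp => ?_
  rw [smul_apply]
  refine norm_nsmul_le.trans (mul_le_mul_of_nonneg_left ?_ (Nat.cast_nonneg _))
  simpa only [norm_neg] using norm_pow_mul_pow_apply_le_max hcomm hA
    ((norm_neg B).trans_le hB) (Finset.HasAntidiagonal.mem_antidiagonal.mp hp) hη
end
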